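/- arXiv:2204.01068 — 2 statements merged into one kernel-verified Lean document; each statement's English description precedes it below -/
import Mathlib

section
/- Let a and b be polynomials over F_2 (or, more generally, elements of a commutative ring of characteristic 2). For n ≥ 1 set u_n = ⟨W_n⟩ and v_n = ⟨W_n'⟩. Then for all n ≥ 1: u_{n+1} = ε_n·u_n^2 and v_{n+1} = ε_n·u_n·v_n + 1, where ε_n = a if n is even and ε_n = b if n is odd. -/
/-- The continuant `⟨W⟩` of a finite word `W` with letters in a commutative ring,
defined by `⟨∅⟩ = 1`, `⟨w⟩ = w` and `⟨W⟩ = w₁⟨W'⟩ + ⟨(W')'⟩`, where `W'` is `W`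
with its first letter deleted. -/
def continuant {R : Type*} [CommRing R] : List R → R
  | [] => 1
  | [x] => x
  | x :: y :: l => x * continuant (y :: l) + continuant l

/-- The morphism `σ` with `σ(a) = ab`, `σ(b) = aa`, on the abstract two-letter
alphabet `Bool` (where `false` stands for `a` and `true` for `b`), extended to
words by concatenation. -/
def pdStep (l : List Bool) : List Bool :=
  l.flatMap fun x => bif x then [false, false] else [false, true]

/-- The abstract word `Wₙ = (σⁿ(a))''`: the word `σⁿ(a)` with its last letter
removed. -/
def pdWordBool (n : ℕ) : List Bool := (pdStep^[n] [false]).dropLast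

/-- The word `Wₙ = (σⁿ(a))''` with letters the elements `a`, `b` of a ring. -/
def pdWord {R : Type*} (a b : R) (n : ℕ) : List R :=
  (pdWordBool n).map fun x => bif x then b else a

/-- The product of the matrices `!![x, 1; 1, 0]` over the letters `x` of a word. -/
def continuantMatrix {R : Type*} [CommRing R] (l : List R) : Matrix (Fin 2) (Fin 2) R :=
  (l.map fun x => !![x, 1; 1, 0]).prod

theorem continuantMatrix_cons {R : Type*} [CommRing R] (x : R) (l : List R) :
    continuantMatrix (x :: l) = !![x, 1; 1, 0] * continuantMatrix l := by
  simp [continuantMatrix]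

theorem continuantMatrix_append {R : Type*} [CommRing R] (l m : List R) :
    continuantMatrix (l ++ m) = continuantMatrix l * continuantMatrix m := by
  simp [continuantMatrix]

theorem continuantMatrix_cons_one_zero {R : Type*} [CommRing R] (x : R) (l : List R) :
    continuantMatrix (x :: l) 1 0 = continuantMatrix l 0 0 := by
  simp [continuantMatrix_cons, Matrix.mul_apply, Fin.sum_univ_two]

theorem continuantMatrix_zero_zero {R : Type*} [CommRing R] (l : List R) :
    continuantMatrix l 0 0 = continuant l := by
  induction l using continuant.induct with
  | case1 => simp [continuantMatrix, continuant]
  | case2 x => simp [continuantMatrix, continuant]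
  | case3 x y l ih₁ ih₂ =>
    rw [continuantMatrix_cons, continuant, ← ih₁, ← ih₂, ← continuantMatrix_cons_one_zero y l]
    simp [Matrix.mul_apply, Fin.sum_univ_two]

theorem continuantMatrix_one_zero {R : Type*} [CommRing R] {l : List R} (hl : l ≠ []) :
    continuantMatrix l 1 0 = continuant l.tail := by
  cases l with
  | nil => exact absurd rfl hl
  | cons x l => rw [continuantMatrix_cons_one_zero, continuantMatrix_zero_zero, List.tail_cons]

theorem pdStep_iterate_append (n : ℕ) (l m : List Bool) :
    pdStep^[n] (l ++ m) = pdStep^[n] l ++ pdStep^[n] m := by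
  induction n generalizing l m with
  | zero => rfl
  | succ n ih => simp [Function.iterate_succ_apply, pdStep, List.flatMap_append, ← ih]

theorem pdStep_iterate_succ_false (n : ℕ) :
    pdStep^[n + 1] [false] = pdStep^[n] [false] ++ pdStep^[n] [true] := by
  rw [← pdStep_iterate_append]; rfl

theorem pdStep_iterate_succ_true (n : ℕ) :
    pdStep^[n + 1] [true] = pdStep^[n] [false] ++ pdStep^[n] [false] := by
  rw [← pdStep_iterate_append]; rfl

theorem pdStep_iterate_eq (n : ℕ) :
    pdStep^[n] [false] = pdWordBool n ++ [!decide (Even n)] ∧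
      pdStep^[n] [true] = pdWordBool n ++ [decide (Even n)] := by
  induction n with
  | zero => simp [pdWordBool]
  | succ n ih =>
    rw [pdWordBool, pdStep_iterate_succ_false, pdStep_iterate_succ_true, ih.1, ih.2,
      ← List.append_assoc _ (pdWordBool n), List.dropLast_concat]
    by_cases h : Even n <;> simp [Nat.even_add_one, h]

theorem pdWordBool_succ (n : ℕ) :
    pdWordBool (n + 1) = pdWordBool n ++ (!decide (Even n)) :: pdWordBool n := by
  rw [pdWordBool, pdStep_iterate_succ_false, (pdStep_iterate_eq n).1, (pdStep_iterate_eq n).2,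
    ← List.append_assoc _ (pdWordBool n), List.dropLast_concat, List.append_assoc,
    List.singleton_append]

theorem pdWord_succ {R : Type*} (a b : R) (n : ℕ) :
    pdWord a b (n + 1) = pdWord a b n ++ (if Even n then a else b) :: pdWord a b n := by
  by_cases h : Even n <;> simp [pdWord, pdWordBool_succ, h]

theorem pdWord_succ_ne_nil {R : Type*} (a b : R) (n : ℕ) : pdWord a b (n + 1) ≠ [] := by
  simp [pdWord_succ]

theorem continuantMatrix_pdWord_succ {R : Type*} [CommRing R] (a b : R) (n : ℕ) :
    continuantMatrix (pdWord a b (n + 1)) = continuantMatrix (pdWord a b n) *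
      (!![if Even n then a else b, 1; 1, 0] * continuantMatrix (pdWord a b n)) := by
  rw [pdWord_succ, continuantMatrix_append, continuantMatrix_cons]

theorem continuantMatrix_pdWord_isSymm {R : Type*} [CommRing R] (a b : R) (n : ℕ) :
    (continuantMatrix (pdWord a b n)).IsSymm := by
  induction n with
  | zero => simp [continuantMatrix, pdWord, pdWordBool]
  | succ n ih =>
    have h (x : R) : (!![x, 1; 1, 0]).transpose = !![x, 1; 1, 0] := by
      ext i j; fin_cases i <;> fin_cases j <;> rfl
    rw [Matrix.IsSymm, continuantMatrix_pdWord_succ, Matrix.transpose_mul, Matrix.transpose_mul,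
      ih.eq, h, Matrix.mul_assoc]

theorem det_continuantMatrix {R : Type*} [CommRing R] (l : List R) :
    (continuantMatrix l).det = (-1) ^ l.length := by
  induction l with
  | nil => simp [continuantMatrix]
  | cons x l ih => rw [continuantMatrix_cons, Matrix.det_mul, ih]; simp [pow_succ']

/-- **Lemma 3.2.**  Let `a`, `b` be elements of a commutative ring of
characteristic 2 and, for `n ≥ 1`, set `uₙ = ⟨Wₙ⟩` and `vₙ = ⟨Wₙ'⟩`.  Then for
all `n ≥ 1` we have `u_{n+1} = εₙ·uₙ²` and `v_{n+1} = εₙ·uₙ·vₙ + 1`, where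
`εₙ = a` if `n` is even and `εₙ = b` if `n` is odd. -/
theorem pd_continuant_recurrence
    {R : Type*} [CommRing R] [CharP R 2] (a b : R)
    (u v : ℕ → R)
    (hu : ∀ n, u n = continuant (pdWord a b n))
    (hv : ∀ n, v n = continuant (pdWord a b n).tail) :
    ∀ n : ℕ, 1 ≤ n →
      u (n + 1) = (if Even n then a else b) * u n ^ 2 ∧
      v (n + 1) = (if Even n then a else b) * u n * v n + 1 := by
  intro n hn
  obtain ⟨n, rfl⟩ := Nat.exists_eq_succ_of_ne_zero (Nat.one_le_iff_ne_zero.mp hn)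
  rw [hu, hu, hv, hv, ← continuantMatrix_one_zero (pdWord_succ_ne_nil a b _),
    ← continuantMatrix_one_zero (pdWord_succ_ne_nil a b _), ← continuantMatrix_zero_zero,
    ← continuantMatrix_zero_zero, continuantMatrix_pdWord_succ a b (n + 1)]
  have hsymm := (continuantMatrix_pdWord_isSymm a b (n + 1)).apply 1 0
  have hdet := det_continuantMatrix (pdWord a b (n + 1))
  rw [CharTwo.neg_eq, one_pow, Matrix.det_fin_two, CharTwo.sub_eq_add] at hdet
  generalize continuantMatrix (pdWord a b (n + 1)) = M at *
  simp only [Matrix.mul_apply, Fin.sum_univ_two, Matrix.of_apply, Matrix.cons_val',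
    Matrix.cons_val_zero, Matrix.cons_val_one, Matrix.cons_val_fin_one]
  rw [hsymm] at *
  constructor
  · linear_combination M 0 0 * M 1 0 * CharTwo.two_eq_zero (R := R)
  · linear_combination hdet
end

section
/- Let K be a field of characteristic 2 equipped with a derivation D (an additive map satisfying the Leibniz rule D(xy) = x·D(y) + D(x)·y). Let a, b, α ∈ K with α ≠ 0, and suppose A·α^4 + B·α^3 + C·α^2 + 1 = 0, where A = ab + b^2 + 1, B = ab(a + b), C = ab. Then D(B·α) = D(ab)·(1 + α^2). In particular, the period-doubling continued fraction α_p ∈ F_2((1/t)) satisfies the Riccati differential equation (ab(a+b)·x)' = (ab)'·(1 + x^2) for the formal derivative ' on F_2((1/t)). -/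
/-- The `(a,b)`-period-doubling sequence: the `n`-th term is `a` when the 2-adic
valuation of `n+1` is even, and `b` when it is odd. -/
def pdSeq {X : Type*} (a b : X) (n : ℕ) : X :=
  if Even (padicValNat 2 (n + 1)) then a else b

/-- The element `t` of `F₂((1/t))`, realized in `LaurentSeries (ZMod 2)` whose
variable `X` stands for `1/t`; thus `t = X⁻¹` is the Hahn series `single (-1) 1`. -/
noncomputable def tt : LaurentSeries (ZMod 2) := HahnSeries.single (-1 : ℤ) 1

/-- The word of the first `n` partial quotients of the period-doubling continued
fraction, viewed inside `F₂((1/t))`. -/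
noncomputable def pdQuotients (a b : Polynomial (ZMod 2)) (n : ℕ) :
    List (LaurentSeries (ZMod 2)) :=
  (List.range n).map fun i => Polynomial.aeval tt (pdSeq a b i)

/-- The `n`-th convergent `[p₀; p₁, …, pₙ]` of the period-doubling continued
fraction, expressed as the quotient of continuants `⟨p₀,…,pₙ⟩ / ⟨p₁,…,pₙ⟩`. -/
noncomputable def pdConvergent (a b : Polynomial (ZMod 2)) (n : ℕ) :
    LaurentSeries (ZMod 2) :=
  continuant (pdQuotients a b (n + 1)) / continuant (pdQuotients a b (n + 1)).tail

/-- The formal derivative (with respect to `t`) on `F₂((1/t))`: the derivative of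
`Σᵢ cᵢ tⁱ` is `Σᵢ i·cᵢ t^{i−1}`.  In the `X = 1/t` realization, the coefficient
of the derivative at exponent `k` is `(1 − k)·c_{k−1}`. -/
noncomputable def Dt (α : LaurentSeries (ZMod 2)) : LaurentSeries (ZMod 2) :=
  { coeff := fun k => (1 - k) • α.coeff (k - 1)
    isPWO_support' := by
      refine Set.IsPWO.mono (α.isPWO_support'.image_of_monotone
        (f := fun x : ℤ => x + 1) fun x y h => by simpa using h) ?_
      intro k hk
      have h1 : α.coeff (k - 1) ≠ 0 := by
        intro h
        apply hk
        simp only [Function.mem_support, h, smul_zero, ne_eq, not_true_eq_false,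
          not_not]
      exact ⟨k - 1, h1, by ring⟩ }

/-- A derivation of a field of characteristic two kills squares, so differentiating the quartic
equation of the period-doubling continued fraction yields a Riccati equation. -/
theorem riccati_of_quartic {K : Type*} [Field K] [CharP K 2] (D : K → K)
    (hadd : ∀ x y : K, D (x + y) = D x + D y)
    (hmul : ∀ x y : K, D (x * y) = x * D y + D x * y) (a b α : K)
    (h : (a * b + b ^ 2 + 1) * α ^ 4 + (a * b * (a + b)) * α ^ 3 + (a * b) * α ^ 2 + 1 = 0) :
    D ((a * b * (a + b)) * α) = D (a * b) * (1 + α ^ 2) := by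
  have h2 : (2 : K) = 0 := CharTwo.two_eq_zero
  have hα : α ≠ 0 := by
    rintro rfl
    simp at h
  have hsq (x : K) : D (x ^ 2) = 0 := by
    rw [pow_two, hmul]
    linear_combination x * D x * h2
  have hsq_mul (x y : K) : D (x * y ^ 2) = D x * y ^ 2 := by
    rw [hmul, hsq, mul_zero, zero_add]
  have hone : D 1 = 0 := by simpa using hsq 1
  have hzero : D 0 = 0 := by simpa using hsq 0
  have hD := congrArg D (show (a * b + b ^ 2 + 1) * (α ^ 2) ^ 2
      + ((a * b * (a + b)) * α) * α ^ 2 + (a * b) * α ^ 2 + 1 = 0 by linear_combination h)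
  rw [hadd, hadd, hadd, hsq_mul, hsq_mul, hsq_mul, hadd, hadd, hsq, hone, hzero] at hD
  refine mul_right_cancel₀ (pow_ne_zero 2 hα) ?_
  linear_combination hD - (D (a * b) * α ^ 4 + D (a * b) * α ^ 2) * h2

/-! ### The formal derivative on `F₂((1/t))` -/

theorem Dt_add (x y : LaurentSeries (ZMod 2)) : Dt (x + y) = Dt x + Dt y := by
  ext k
  simp [Dt]

/-- The Euler operator `X d/dX` on Laurent series over `F₂`. -/
noncomputable def eulerOp (x : LaurentSeries (ZMod 2)) : LaurentSeries (ZMod 2) where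
  coeff k := (k : ZMod 2) * x.coeff k
  isPWO_support' := x.isPWO_support.mono fun k hk h => hk (by simp [h])

theorem eulerOp_coeff (x : LaurentSeries (ZMod 2)) (k : ℤ) :
    (eulerOp x).coeff k = (k : ZMod 2) * x.coeff k := rfl

theorem eulerOp_support_subset (x : LaurentSeries (ZMod 2)) :
    (eulerOp x).support ⊆ x.support := fun k hk h => hk (by simp [eulerOp_coeff, h])

theorem eulerOp_mul (x y : LaurentSeries (ZMod 2)) :
    eulerOp (x * y) = x * eulerOp y + eulerOp x * y := by
  ext k
  rw [HahnSeries.coeff_add, eulerOp_coeff, HahnSeries.coeff_mul,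
    HahnSeries.coeff_mul_right' y.isPWO_support (eulerOp_support_subset y),
    HahnSeries.coeff_mul_left' x.isPWO_support (eulerOp_support_subset x),
    Finset.mul_sum, ← Finset.sum_add_distrib]
  refine Finset.sum_congr rfl fun ij hij => ?_
  rw [Finset.mem_antidiagonal] at hij
  obtain ⟨-, -, rfl⟩ := hij
  simp only [eulerOp_coeff]
  push_cast
  ring

theorem Dt_eq_single_mul_eulerOp (x : LaurentSeries (ZMod 2)) :
    Dt x = HahnSeries.single 1 1 * eulerOp x := by
  ext k
  rw [HahnSeries.coeff_single_mul, eulerOp_coeff, one_mul]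
  change (1 - k) • x.coeff (k - 1) = _
  rw [zsmul_eq_mul, ← neg_sub k 1, Int.cast_neg, CharTwo.neg_eq]

theorem Dt_mul (x y : LaurentSeries (ZMod 2)) : Dt (x * y) = x * Dt y + Dt x * y := by
  simp only [Dt_eq_single_mul_eulerOp, eulerOp_mul]
  ring

/-! ### Polynomials in `t` inside `F₂((1/t))` -/

theorem tt_pow (n : ℕ) : tt ^ n = HahnSeries.single (-n : ℤ) 1 := by
  simp [tt, HahnSeries.single_pow]

open Polynomial in
theorem coeff_aeval_tt (p : (ZMod 2)[X]) (n : ℕ) :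
    (aeval tt p).coeff (-n : ℤ) = p.coeff n := by
  induction p using Polynomial.induction_on' with
  | add p q hp hq => simp [hp, hq]
  | monomial m c =>
    rw [aeval_monomial, tt_pow, coeff_monomial]
    obtain rfl | rfl : c = 0 ∨ c = 1 := by
      revert c
      decide
    · simp
    · simp [HahnSeries.coeff_single, eq_comm]

open Polynomial in
theorem exp_natDegree_le_v_aeval_tt {p : (ZMod 2)[X]} (hp : p ≠ 0) :
    WithZero.exp (p.natDegree : ℤ) ≤ Valued.v (aeval tt p) := by
  by_contra! hlt
  have hle : Valued.v (aeval tt p) ≤ WithZero.exp (-(1 - p.natDegree : ℤ)) := by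
    rcases eq_or_ne (Valued.v (aeval tt p)) 0 with h0 | h0
    · simp [h0]
    · rw [← WithZero.log_lt_iff_lt_exp h0] at hlt
      rw [← WithZero.log_le_iff_le_exp h0]
      lia
  have := (LaurentSeries.valuation_le_iff_coeff_lt_eq_zero (ZMod 2)).1 hle
    (-p.natDegree) (by lia)
  rw [coeff_aeval_tt] at this
  exact hp (leadingCoeff_eq_zero.1 this)

open Polynomial Filter in
theorem tendsto_inv_aeval_tt {p : ℕ → (ZMod 2)[X]} (hp : ∀ n, p n ≠ 0)
    (hdeg : ∀ n, n ≤ (p n).natDegree) :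
    Tendsto (fun n => (aeval tt (p n))⁻¹) atTop (nhds 0) := by
  rw [(Valued.hasBasis_nhds_zero _ _).tendsto_right_iff]
  intro γ _
  obtain ⟨N, hN⟩ := WithZero.exists_exp_neg_natCast_lt
    (x := MonoidWithZeroHom.ValueGroup₀.embedding γ.1) (by simp)
  filter_upwards [eventually_ge_atTop N] with n hn
  rw [Valuation.restrict_lt_iff_lt_embedding]
  refine lt_of_le_of_lt ?_ hN
  rw [map_inv₀, WithZero.exp_neg]
  refine inv_anti₀ WithZero.exp_pos (le_trans ?_ (exp_natDegree_le_v_aeval_tt (hp n)))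
  rw [WithZero.exp_le_exp]
  exact_mod_cast hn.trans (hdeg n)

open Polynomial in
theorem aeval_tt_injective : Function.Injective (aeval tt : (ZMod 2)[X] →ₐ[ZMod 2] _) := by
  rw [injective_iff_map_eq_zero]
  intro p h
  ext n
  rw [← coeff_aeval_tt, h]
  simp

/-! ### Continuants and matrix products -/

/-- The matrix of a single partial quotient. -/
def quotientMatrix {R : Type*} [CommRing R] (x : R) : Matrix (Fin 2) (Fin 2) R := !![x, 1; 1, 0]

theorem continuant_eq_prod_quotientMatrix {R : Type*} [CommRing R] (l : List R) :
    continuant l = (l.map quotientMatrix).prod 0 0 ∧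
      (l ≠ [] → continuant l.tail = (l.map quotientMatrix).prod 1 0) := by
  induction l with
  | nil => simp [continuant]
  | cons x l ih =>
    obtain ⟨h0, h1⟩ := ih
    cases l with
    | nil => simp [continuant, quotientMatrix]
    | cons y l =>
      have h1 := h1 (List.cons_ne_nil _ _)
      rw [List.map_cons, List.prod_cons, Matrix.mul_apply, Matrix.mul_apply, Fin.sum_univ_two,
        Fin.sum_univ_two, ← h0, ← h1]
      simp [continuant, quotientMatrix]

/-! ### The period-doubling word -/

theorem padicValNat_two_pow_add {n m : ℕ} (hm : m ≠ 0) (hmn : m < 2 ^ n) :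
    padicValNat 2 (2 ^ n + m) = padicValNat 2 m := by
  have hlt : padicValNat 2 m < n := by
    by_contra! h
    exact absurd (Nat.le_of_dvd (by lia) ((padicValNat_dvd_iff_le hm).2 h)) (by lia)
  have h := padicValRat.add_eq_of_lt (p := 2) (q := m) (r := (2 ^ n : ℕ))
    (by positivity) (by positivity) (by positivity)
    (by rw [padicValRat.of_nat, padicValRat.of_nat, padicValNat.prime_pow]; exact_mod_cast hlt)
  rw [← Nat.cast_add, padicValRat.of_nat, padicValRat.of_nat] at h
  rw [add_comm]
  exact_mod_cast h

/-- The numerator `⟨p₀,…,pₘ⟩` for `m + 1 = 2 ^ n - 1`, in characteristic two. -/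
def pdNum {R : Type*} [CommRing R] (a b : R) : ℕ → R
  | 0 => 1
  | n + 1 => pdNum a b n ^ 2 * if Even n then a else b

/-- The denominator `⟨p₁,…,pₘ⟩` for `m + 1 = 2 ^ n - 1`, in characteristic two. -/
def pdDen {R : Type*} [CommRing R] (a b : R) : ℕ → R
  | 0 => 0
  | n + 1 => pdNum a b n * pdDen a b n * (if Even n then a else b) + 1

theorem map_pdNum {R S : Type*} [CommRing R] [CommRing S] (f : R →+* S) (a b : R) (n : ℕ) :
    f (pdNum a b n) = pdNum (f a) (f b) n := by
  induction n with
  | zero => simp [pdNum]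
  | succ n ih => simp [pdNum, ih, apply_ite f]

theorem map_pdDen {R S : Type*} [CommRing R] [CommRing S] (f : R →+* S) (a b : R) (n : ℕ) :
    f (pdDen a b n) = pdDen (f a) (f b) n := by
  induction n with
  | zero => simp [pdDen]
  | succ n ih => simp [pdDen, ih, map_pdNum, apply_ite f]

theorem pdSeq_two_pow_sub_one {X : Type*} (a b : X) (n : ℕ) :
    pdSeq a b (2 ^ n - 1) = if Even n then a else b := by
  simp [pdSeq, Nat.sub_add_cancel Nat.one_le_two_pow]

theorem map_range_pdSeq_succ {X : Type*} (a b : X) (n : ℕ) :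
    (List.range (2 ^ (n + 1) - 1)).map (pdSeq a b) =
      (List.range (2 ^ n - 1)).map (pdSeq a b) ++
        (if Even n then a else b) :: (List.range (2 ^ n - 1)).map (pdSeq a b) := by
  have hpos : 1 ≤ 2 ^ n := Nat.one_le_two_pow
  rw [show 2 ^ (n + 1) - 1 = (2 ^ n - 1 + 1) + (2 ^ n - 1) by lia, List.range_add,
    List.range_succ]
  simp only [List.map_append, List.map_cons, List.append_assoc, List.singleton_append,
    pdSeq_two_pow_sub_one, List.map_map]
  congr 2
  refine List.map_congr_left fun i hi => ?_
  rw [List.mem_range] at hi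
  simp only [Function.comp, pdSeq]
  rw [show 2 ^ n - 1 + 1 + i + 1 = 2 ^ n + (i + 1) by lia,
    padicValNat_two_pow_add (by lia) (by lia)]

theorem prod_quotientMatrix_pdSeq {R : Type*} [CommRing R] [CharP R 2] (a b : R) (n : ℕ) :
    ∃ s : R, pdNum a b n * s + pdDen a b n ^ 2 = 1 ∧
      (((List.range (2 ^ n - 1)).map (pdSeq a b)).map quotientMatrix).prod =
        !![pdNum a b n, pdDen a b n; pdDen a b n, s] := by
  have h2 : (2 : R) = 0 := CharTwo.two_eq_zero
  induction n with
  | zero => exact ⟨1, by simp [pdNum, pdDen], by simp [pdNum, pdDen, Matrix.one_fin_two]⟩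
  | succ n ih =>
    obtain ⟨s, hs, hprod⟩ := ih
    rw [map_range_pdSeq_succ, List.map_append, List.map_cons, List.prod_append, List.prod_cons,
      hprod]
    simp only [pdNum, pdDen]
    generalize (if Even n then a else b) = x
    generalize pdNum a b n = p at *
    generalize pdDen a b n = q at *
    refine ⟨q ^ 2 * x, ?_, ?_⟩
    · linear_combination (p ^ 2 * q ^ 2 * x ^ 2 + p * q * x) * h2
    · ext i j
      fin_cases i <;> fin_cases j <;> simp [quotientMatrix]
      · linear_combination p * q * h2
      · linear_combination hs
      · linear_combination hs
      · linear_combination q * s * h2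

theorem pdNum_pdDen_quartic {R : Type*} [CommRing R] [CharP R 2] (a b : R) (n : ℕ) :
    (a * b + b ^ 2 + 1) * pdNum a b n ^ 4 + (a * b * (a + b)) * (pdNum a b n ^ 3 * pdDen a b n)
        + a * b * (pdNum a b n ^ 2 * pdDen a b n ^ 2) + pdDen a b n ^ 4 =
      pdNum a b n ^ 2 * (a * b + (if Even n then b else a) ^ 2) + 1 := by
  have h2 : (2 : R) = 0 := CharTwo.two_eq_zero
  induction n with
  | zero => simp [pdNum, pdDen]
  | succ n ih =>
    simp only [pdNum, pdDen, Nat.even_add_one]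
    generalize pdNum a b n = p at *
    generalize pdDen a b n = q at *
    by_cases hn : Even n
    · simp only [hn, if_true, not_true, if_false] at *
      linear_combination a ^ 4 * p ^ 4 * ih + (2 * p ^ 3 * q ^ 3 * a ^ 3
        + 3 * p ^ 2 * q ^ 2 * a ^ 2 + 2 * p * q * a + a * b * p ^ 5 * q * a ^ 3
        + p ^ 6 * a ^ 4 * (a * b + b ^ 2)) * h2
    · simp only [hn, if_true, not_false_eq_true, if_false] at *
      linear_combination b ^ 4 * p ^ 4 * ih + (2 * p ^ 3 * q ^ 3 * b ^ 3
        + 3 * p ^ 2 * q ^ 2 * b ^ 2 + 2 * p * q * b + a * b * p ^ 5 * q * b ^ 3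
        + p ^ 6 * b ^ 4 * (a * b + a ^ 2)) * h2

open Polynomial in
theorem pdNum_ne_zero {a b : (ZMod 2)[X]} (ha : a ≠ 0) (hb : b ≠ 0) (n : ℕ) :
    pdNum a b n ≠ 0 := by
  induction n with
  | zero => simp [pdNum]
  | succ n ih =>
    rw [pdNum]
    refine mul_ne_zero (pow_ne_zero 2 ih) ?_
    split_ifs <;> assumption

open Polynomial in
theorem le_natDegree_pdNum {a b : (ZMod 2)[X]} (ha : 0 < a.natDegree) (hb : 0 < b.natDegree)
    (n : ℕ) : n ≤ (pdNum a b n).natDegree := by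
  have ha0 : a ≠ 0 := ne_zero_of_natDegree_gt ha
  have hb0 : b ≠ 0 := ne_zero_of_natDegree_gt hb
  induction n with
  | zero => simp
  | succ n ih =>
    have := pdNum_ne_zero ha0 hb0 n
    rw [pdNum]
    split_ifs
    · rw [natDegree_mul (pow_ne_zero 2 this) ha0, natDegree_pow]
      lia
    · rw [natDegree_mul (pow_ne_zero 2 this) hb0, natDegree_pow]
      lia

open Polynomial in
theorem pdDen_succ_ne_zero {a b : (ZMod 2)[X]} (ha : 0 < a.natDegree) (hb : 0 < b.natDegree)
    (n : ℕ) : pdDen a b (n + 1) ≠ 0 := by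
  intro h
  rw [pdDen, CharTwo.add_eq_zero] at h
  have hu : IsUnit (if Even n then a else b) := IsUnit.of_mul_eq_one_right _ h
  have h0 := natDegree_eq_zero_of_isUnit hu
  split_ifs at h0 <;> lia

open Polynomial in
theorem pdConvergent_two_pow (a b : (ZMod 2)[X]) (n : ℕ) :
    pdConvergent a b (2 ^ (n + 1) - 2) =
      aeval tt (pdNum a b (n + 1)) / aeval tt (pdDen a b (n + 1)) := by
  have : CharP (LaurentSeries (ZMod 2)) 2 :=
    charP_of_injective_algebraMap (algebraMap (ZMod 2) (LaurentSeries (ZMod 2))).injective 2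
  have hpos : 1 ≤ 2 ^ n := Nat.one_le_two_pow
  have hlen : 2 ^ (n + 1) - 2 + 1 = 2 ^ (n + 1) - 1 := by lia
  have hword : pdQuotients a b (2 ^ (n + 1) - 2 + 1) =
      (List.range (2 ^ (n + 1) - 1)).map (pdSeq (aeval tt a) (aeval tt b)) := by
    rw [hlen, pdQuotients]
    refine List.map_congr_left fun i _ => ?_
    simp only [pdSeq, apply_ite (aeval tt)]
  obtain ⟨s, -, hs⟩ := prod_quotientMatrix_pdSeq (aeval tt a) (aeval tt b) (n + 1)
  have hne : (List.range (2 ^ (n + 1) - 1)).map (pdSeq (aeval tt a) (aeval tt b)) ≠ [] := by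
    simp only [ne_eq, List.map_eq_nil_iff, List.range_eq_nil]
    lia
  have hc := continuant_eq_prod_quotientMatrix
    ((List.range (2 ^ (n + 1) - 1)).map (pdSeq (aeval tt a) (aeval tt b)))
  have hnum := map_pdNum (aeval tt : (ZMod 2)[X] →ₐ[ZMod 2] _).toRingHom a b (n + 1)
  have hden := map_pdDen (aeval tt : (ZMod 2)[X] →ₐ[ZMod 2] _).toRingHom a b (n + 1)
  simp only [AlgHom.toRingHom_eq_coe, RingHom.coe_coe] at hnum hden
  rw [pdConvergent, hword, hc.1, hc.2 hne, hs, hnum, hden]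
  simp

open Polynomial Filter in
/-- The period-doubling continued fraction is a root of an explicit quartic. -/
theorem quartic_of_tendsto_pdConvergent {a b : (ZMod 2)[X]} (ha : 0 < a.natDegree)
    (hb : 0 < b.natDegree) {α : LaurentSeries (ZMod 2)}
    (hα : Tendsto (pdConvergent a b) atTop (nhds α)) :
    (aeval tt a * aeval tt b + aeval tt b ^ 2 + 1) * α ^ 4
      + (aeval tt a * aeval tt b * (aeval tt a + aeval tt b)) * α ^ 3
      + (aeval tt a * aeval tt b) * α ^ 2 + 1 = 0 := by
  have hmono : StrictMono fun k : ℕ => 2 * k + 1 + 1 := fun i j h => by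
    change 2 * i + 1 + 1 < 2 * j + 1 + 1
    lia
  have hsub : Tendsto (fun k : ℕ => 2 ^ (2 * k + 1 + 1) - 2) atTop atTop := by
    refine tendsto_atTop_mono (fun k => ?_) tendsto_id
    have := Nat.lt_two_pow_self (n := 2 * k + 1 + 1)
    simp only [id]
    lia
  have hconv := hα.comp hsub
  simp only [Function.comp_def, pdConvergent_two_pow] at hconv
  have hinv := (tendsto_inv_aeval_tt
    (pdNum_ne_zero (ne_zero_of_natDegree_gt ha) (ne_zero_of_natDegree_gt hb))
    (le_natDegree_pdNum ha hb)).comp hmono.tendsto_atTop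
  simp only [Function.comp_def] at hinv
  have hL := (((hconv.pow 4).const_mul (aeval tt a * aeval tt b + aeval tt b ^ 2 + 1)).add
    ((hconv.pow 3).const_mul (aeval tt a * aeval tt b * (aeval tt a + aeval tt b)))).add
    ((hconv.pow 2).const_mul (aeval tt a * aeval tt b)) |>.add_const 1
  have hR := (hconv.pow 4).mul
    (((hinv.pow 2).mul_const (aeval tt a * aeval tt b + aeval tt b ^ 2)).add (hinv.pow 4))
  refine (tendsto_nhds_unique hL (hR.congr fun k => ?_)).trans (by simp)
  have hq : aeval tt (pdDen a b (2 * k + 1 + 1)) ≠ 0 :=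
    (map_ne_zero_iff _ aeval_tt_injective).2 (pdDen_succ_ne_zero ha hb _)
  have hp : aeval tt (pdNum a b (2 * k + 1 + 1)) ≠ 0 :=
    (map_ne_zero_iff _ aeval_tt_injective).2
      (pdNum_ne_zero (ne_zero_of_natDegree_gt ha) (ne_zero_of_natDegree_gt hb) _)
  have h := congrArg (aeval tt) (pdNum_pdDen_quartic a b (2 * k + 1 + 1))
  rw [if_pos (by use k + 1; lia)] at h
  simp only [map_add, map_mul, map_pow, map_one] at h
  generalize aeval tt (pdDen a b (2 * k + 1 + 1)) = q at *
  generalize aeval tt (pdNum a b (2 * k + 1 + 1)) = p at *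
  field_simp
  linear_combination -h

/-- **Proposition.**  Let `K` be a field of characteristic 2 with a derivation
`D` (an additive map satisfying the Leibniz rule).  If `a, b, α ∈ K`, `α ≠ 0`
and `A·α⁴ + B·α³ + C·α² + 1 = 0` with `A = ab + b² + 1`, `B = ab(a+b)`,
`C = ab`, then `D(B·α) = D(ab)·(1 + α²)`.  In particular, the period-doubling
continued fraction `α_p ∈ F₂((1/t))` satisfies the Riccati differential
equation `(ab(a+b)·x)' = (ab)'·(1 + x²)` for the formal derivative on
`F₂((1/t))`. -/
theorem pd_riccati :
    (∀ (K : Type*) [Field K] [CharP K 2] (D : K → K),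
        (∀ x y : K, D (x + y) = D x + D y) →
        (∀ x y : K, D (x * y) = x * D y + D x * y) →
        ∀ a b α : K, α ≠ 0 →
          (a * b + b ^ 2 + 1) * α ^ 4 + (a * b * (a + b)) * α ^ 3
              + (a * b) * α ^ 2 + 1 = 0 →
          D ((a * b * (a + b)) * α) = D (a * b) * (1 + α ^ 2)) ∧
    (∀ a b : Polynomial (ZMod 2), a ≠ b → 0 < a.natDegree → 0 < b.natDegree →
        ∀ α : LaurentSeries (ZMod 2),
          Filter.Tendsto (pdConvergent a b) Filter.atTop (nhds α) →
          Dt (Polynomial.aeval tt (a * b * (a + b)) * α) =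
            Dt (Polynomial.aeval tt (a * b)) * (1 + α ^ 2)) := by
  refine ⟨fun K _ _ D hadd hmul a b α _ h => riccati_of_quartic D hadd hmul a b α h,
    fun a b _ ha hb α hα => ?_⟩
  have : CharP (LaurentSeries (ZMod 2)) 2 :=
    charP_of_injective_algebraMap (algebraMap (ZMod 2) (LaurentSeries (ZMod 2))).injective 2
  simpa only [map_mul, map_add] using
    riccati_of_quartic Dt Dt_add Dt_mul _ _ α (quartic_of_tendsto_pdConvergent ha hb hα)
end
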